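/- Let G be a graph and let v1, v2 be vertices of G. The divisors (v1) and (v2) are linearly equivalent if and only if v1 = v2 or there is a path in G from v1 to v2 none of whose edges is contained in any cycle of G (equivalently, v1 and v2 are identified when every edge of G not contained in a cycle is contracted). -/

import Mathlib

open Finset

variable {V : Type}

/-- Degree of a vertex in the multigraph with edge multiplicities `m`. -/
def mdeg [Fintype V] (m : V → V → ℕ) (v : V) : ℕ := ∑ w, m v w

/-- The Laplacian of an integer-valued function on the vertices. -/
def laplacian [Fintype V] (m : V → V → ℕ) (f : V → ℤ) : V → ℤ :=
  fun v => (mdeg m v : ℤ) * f v - ∑ w, (m v w : ℤ) * f w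

/-- Linear equivalence of divisors. -/
def LinEquiv [Fintype V] (m : V → V → ℕ) (D D' : V → ℤ) : Prop :=
  ∃ f : V → ℤ, D - D' = laplacian m f

/-- A divisor is effective if it is nonnegative everywhere. -/
def Effective (D : V → ℤ) : Prop := ∀ v, 0 ≤ D v

/-- Degree of a divisor. -/
def divDeg [Fintype V] (D : V → ℤ) : ℤ := ∑ v, D v

/-- `D` is linearly equivalent to some effective divisor. -/
def Winnable [Fintype V] (m : V → V → ℕ) (D : V → ℤ) : Prop :=
  ∃ E, Effective E ∧ LinEquiv m D E

/-- Number of edges of the multigraph. -/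
def edgeCount [Fintype V] (m : V → V → ℕ) : ℤ := (∑ v, ∑ w, (m v w : ℤ)) / 2

/-- The genus `g = |E| - |V| + 1`. -/
def genus [Fintype V] (m : V → V → ℕ) : ℤ := edgeCount m - Fintype.card V + 1

/-- `m` describes a graph: symmetric, loopless, and connected. -/
def IsGraph [Fintype V] (m : V → V → ℕ) : Prop :=
  (∀ v w, m v w = m w v) ∧ (∀ v, m v v = 0) ∧
  (SimpleGraph.fromRel (fun v w => 0 < m v w)).Connected


/-- The divisor `(v0)`. -/
def basisDiv [DecidableEq V] (v0 : V) : V → ℤ := fun v => if v = v0 then 1 else 0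

open Classical in
/-- The multiplicity function obtained by deleting the edge between `u` and `v`. -/
noncomputable def removeEdge (m : V → V → ℕ) (u v : V) : V → V → ℕ :=
  fun a b => if (a = u ∧ b = v) ∨ (a = v ∧ b = u) then 0 else m a b

/-- The (unique) edge between `u` and `v` exists and is contained in no cycle of the
connected multigraph `m`: there is exactly one edge between `u` and `v`, and
deleting it disconnects the graph. -/
def IsBridge [Fintype V] (m : V → V → ℕ) (u v : V) : Prop :=
  m u v = 1 ∧ ¬ (SimpleGraph.fromRel (fun a b => 0 < removeEdge m u v a b)).Connected

theorem lap_eq [Fintype V] (m : V → V → ℕ) (f : V → ℤ) (x : V) :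
    laplacian m f x = ∑ w, (m x w : ℤ) * (f x - f w) := by
  simp only [laplacian, mdeg, mul_sub, Finset.sum_sub_distrib, Nat.cast_sum, Finset.sum_mul]

theorem lap_sum [Fintype V] [DecidableEq V] (m : V → V → ℕ) (hs : ∀ v w, m v w = m w v)
    (f : V → ℤ) (S : Finset V) :
    ∑ x ∈ S, laplacian m f x = ∑ x ∈ S, ∑ w ∈ Sᶜ, (m x w : ℤ) * (f x - f w) := by
  have h : ∑ x ∈ S, ∑ w ∈ S, (m x w : ℤ) * (f x - f w) = 0 := by
    have h1 : ∑ x ∈ S, ∑ w ∈ S, (m x w : ℤ) * (f x - f w)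
        = - ∑ x ∈ S, ∑ w ∈ S, (m x w : ℤ) * (f x - f w) := by
      conv_lhs => rw [Finset.sum_comm]
      rw [← Finset.sum_neg_distrib]
      refine Finset.sum_congr rfl fun x _ => ?_
      rw [← Finset.sum_neg_distrib]
      refine Finset.sum_congr rfl fun w _ => ?_
      rw [hs w x]; ring
    omega
  simp only [lap_eq, ← Finset.sum_add_sum_compl S (fun w => (m _ w : ℤ) * (f _ - f w)),
    Finset.sum_add_distrib, h, zero_add]

theorem cut_lap [Fintype V] [DecidableEq V] (m : V → V → ℕ) (hs : ∀ v w, m v w = m w v)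
    (S : Finset V) (u v : V) (hu : u ∈ S) (hv : v ∉ S)
    (hc : ∀ a ∈ S, ∀ b, b ∉ S → m a b = if a = u ∧ b = v then 1 else 0) :
    laplacian m (fun x => if x ∈ S then 1 else 0) = basisDiv u - basisDiv v := by
  funext x
  rw [lap_eq]
  have : ∀ w, (m x w : ℤ) * ((if x ∈ S then 1 else 0) - (if w ∈ S then 1 else 0))
      = (if w = v then (if x = u then 1 else 0) else 0)
        - (if w = u then (if x = v then 1 else 0) else 0) := by
    intro w
    by_cases hx : x ∈ S <;> by_cases hw : w ∈ S
    · have : w ≠ v := fun h => hv (h ▸ hw)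
      have : x ≠ v := fun h => hv (h ▸ hx)
      simp [*]
    · have : w ≠ u := fun h => hw (h ▸ hu)
      have h2 := hc x hx w hw
      by_cases x = u <;> by_cases w = v <;> simp_all
    · have : x ≠ u := fun h => hx (h ▸ hu)
      have : w ≠ v := fun h => hv (h ▸ hw)
      have h2 := hc w hw x hx
      rw [hs w x] at h2
      by_cases x = v <;> by_cases w = u <;> simp_all
    · have : w ≠ u := fun h => hw (h ▸ hu)
      have : x ≠ u := fun h => hx (h ▸ hu)
      simp [*]
  simp only [this, Finset.sum_sub_distrib]
  simp [basisDiv]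

theorem cut_bridge [Fintype V] [DecidableEq V] (m : V → V → ℕ) (hs : ∀ v w, m v w = m w v)
    (S : Finset V) (u v : V) (hu : u ∈ S) (hv : v ∉ S)
    (hc : ∀ a ∈ S, ∀ b, b ∉ S → m a b = if a = u ∧ b = v then 1 else 0) :
    IsBridge m u v := by
  refine ⟨by simpa using hc u hu v hv, fun hcon => ?_⟩
  have key : ∀ a ∈ S, ∀ b,
      (SimpleGraph.fromRel (fun a b => 0 < removeEdge m u v a b)).Adj a b → b ∈ S := by
    intro a ha b hab
    by_contra hb
    have h := hc a ha b hb
    have h' := hs a b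
    rw [SimpleGraph.fromRel_adj] at hab
    simp only [removeEdge] at hab
    grind
  obtain ⟨p⟩ := hcon.preconnected u v
  have : ∀ a b, (SimpleGraph.fromRel (fun a b => 0 < removeEdge m u v a b)).Walk a b →
      a ∈ S → b ∈ S := by
    intro a b p
    induction p with
    | nil => exact id
    | cons h _ ih => exact fun ha => ih (key _ ha _ h)
  exact hv (this u v p hu)

theorem bridge_linEquiv [Fintype V] [DecidableEq V] (m : V → V → ℕ) (hm : IsGraph m) (u v : V)
    (h : IsBridge m u v) : LinEquiv m (basisDiv u) (basisDiv v) := by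
  classical
  obtain ⟨hs, hl, hcon⟩ := hm
  obtain ⟨h1, h2⟩ := h
  set G := SimpleGraph.fromRel (fun a b => 0 < removeEdge m u v a b) with hG
  have step : ∀ a b, 0 < m a b → ¬ (a = u ∧ b = v) → ¬ (a = v ∧ b = u) → G.Adj a b := by
    intro a b hab n1 n2
    rw [hG, SimpleGraph.fromRel_adj]
    refine ⟨?_, Or.inl ?_⟩
    · rintro rfl
      rw [hl] at hab
      exact absurd hab (lt_irrefl _)
    · simp only [removeEdge]
      rw [if_neg (by tauto)]
      exact hab
  have hv : ¬ G.Reachable u v := by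
    intro huv
    apply h2
    haveI := hcon.nonempty
    refine ⟨fun x y => ?_⟩
    obtain ⟨p⟩ := hcon.preconnected x y
    induction p with
    | nil => exact SimpleGraph.Reachable.refl _
    | @cons a b c hab _ ih =>
      refine SimpleGraph.Reachable.trans ?_ ih
      rw [SimpleGraph.fromRel_adj] at hab
      have hab' : 0 < m a b := by
        rcases hab.2 with h | h
        · exact h
        · rw [hs]; exact h
      by_cases n1 : a = u ∧ b = v
      · rw [n1.1, n1.2]; exact huv
      by_cases n2 : a = v ∧ b = u
      · rw [n2.1, n2.2]; exact huv.symm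
      exact (step a b hab' n1 n2).reachable
  refine ⟨_, (cut_lap m hs (Finset.univ.filter fun x => G.Reachable u x) u v (by simp)
    (by simpa using hv) ?_).symm⟩
  intro a ha b hb
  simp only [Finset.mem_filter, Finset.mem_univ, true_and] at ha hb
  split_ifs with hc
  · rw [hc.1, hc.2, h1]
  · by_contra hne
    refine hb (ha.trans (step a b (Nat.pos_of_ne_zero hne) hc ?_).reachable)
    rintro ⟨rfl, rfl⟩
    exact hv ha

theorem lap_sub [Fintype V] (m : V → V → ℕ) (f g : V → ℤ) :
    laplacian m (f - g) = laplacian m f - laplacian m g := by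
  funext x
  simp only [lap_eq, Pi.sub_apply, ← Finset.sum_sub_distrib]
  exact Finset.sum_congr rfl fun _ _ => by ring

theorem lap_add [Fintype V] (m : V → V → ℕ) (f g : V → ℤ) :
    laplacian m (f + g) = laplacian m f + laplacian m g := by
  funext x
  simp only [lap_eq, Pi.add_apply, ← Finset.sum_add_distrib]
  exact Finset.sum_congr rfl fun _ _ => by ring

theorem forward [Fintype V] [DecidableEq V] (m : V → V → ℕ) (hs : ∀ v w, m v w = m w v)
    (v2 : V) (n : ℕ) : ∀ (v1 : V) (f : V → ℤ), (f v1 - f v2).toNat ≤ n →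
    basisDiv v1 - basisDiv v2 = laplacian m f → Relation.ReflTransGen (IsBridge m) v1 v2 := by
  induction n with
  | zero => ?_
  | succ n ih => ?_
  all_goals
    intro v1 f hn hf
    by_cases h12 : v1 = v2
    · rw [h12]
    have hlap : laplacian m f v1 = 1 := by
      rw [← hf]; simp [basisDiv, h12]
    obtain ⟨w, hw0, hw⟩ : ∃ w, 0 < m v1 w ∧ f w < f v1 := by
      by_contra hcon
      push Not at hcon
      have : laplacian m f v1 ≤ 0 := by
        rw [lap_eq]
        refine Finset.sum_nonpos fun w _ => ?_
        rcases Nat.eq_zero_or_pos (m v1 w) with h | h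
        · simp [h]
        · exact mul_nonpos_of_nonneg_of_nonpos (by positivity) (by linarith [hcon w h])
      omega
    set S := Finset.univ.filter (fun x => f v1 ≤ f x) with hS
    have memS : ∀ x, x ∈ S ↔ f v1 ≤ f x := by simp [hS]
    have hsum := lap_sum m hs f S
    have hl : ∑ x ∈ S, laplacian m f x = 1 - if v2 ∈ S then 1 else 0 := by
      rw [← hf]
      simp [basisDiv, Finset.sum_sub_distrib, memS]
    have hnn : ∀ a ∈ S, ∀ b, b ∉ S → 0 ≤ (m a b : ℤ) * (f a - f b) := by
      intro a ha b hb
      rw [memS] at ha hb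
      exact mul_nonneg (by positivity) (by linarith)
    have hpos : ∀ a ∈ S, ∀ b, b ∉ S → (m a b : ℤ) ≤ (m a b : ℤ) * (f a - f b) := by
      intro a ha b hb
      rw [memS] at ha hb
      nlinarith [Int.natCast_nonneg (m a b)]
    rw [← Finset.sum_product', hl] at hsum
    have hnn' : ∀ p ∈ S ×ˢ Sᶜ, 0 ≤ (m p.1 p.2 : ℤ) * (f p.1 - f p.2) := by
      intro p hp
      simp only [Finset.mem_product, Finset.mem_compl] at hp
      exact hnn _ hp.1 _ hp.2
    have hv1S : v1 ∈ S := by simp [memS]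
    have hwS : w ∉ S := by rw [memS]; omega
    have hmem : (v1, w) ∈ S ×ˢ Sᶜ := by simp [hv1S, hwS]
    have hle := Finset.single_le_sum hnn' hmem
    have hp1 := hpos v1 hv1S w hwS
    simp only at hle
    have hv2S : v2 ∉ S := by
      intro h
      rw [if_pos h] at hsum
      omega
    rw [if_neg hv2S] at hsum
    have hc : ∀ a ∈ S, ∀ b, b ∉ S → m a b = if a = v1 ∧ b = w then 1 else 0 := by
      intro a ha b hb
      split_ifs with h
      · rw [h.1, h.2]; omega
      · have hmem2 : (a, b) ∈ S ×ˢ Sᶜ := by simp [ha, hb]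
        have hne : (a, b) ≠ (v1, w) := by
          intro h'
          exact h (by simpa using h')
        have := Finset.add_le_sum hnn' hmem2 hmem hne
        simp only at this
        have := hpos a ha b hb
        omega
    have hbr := cut_bridge m hs S v1 w hv1S hwS hc
    have hcl := cut_lap m hs S v1 w hv1S hwS hc
    have hlt : f v2 < f v1 := by rw [memS] at hv2S; omega
  · omega
  · refine Relation.ReflTransGen.head hbr
      (ih w (f - fun x => if x ∈ S then 1 else 0) ?_ ?_)
    · simp only [Pi.sub_apply, if_neg hwS, if_neg hv2S]
      omega
    · rw [lap_sub, hcl, ← hf]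
      abel

theorem linEquiv_single_vertices_iff [Fintype V] [DecidableEq V]
    (m : V → V → ℕ) (hm : IsGraph m) (v1 v2 : V) :
    LinEquiv m (basisDiv v1) (basisDiv v2) ↔
      (v1 = v2 ∨ Relation.ReflTransGen (IsBridge m) v1 v2) := by
  constructor
  · rintro ⟨f, hf⟩
    exact Or.inr (forward m hm.1 v2 _ v1 f le_rfl hf)
  · intro h
    have h : Relation.ReflTransGen (IsBridge m) v1 v2 := by
      rcases h with h | h
      · rw [h]
      · exact h
    induction h with
    | refl => exact ⟨0, by funext x; simp [laplacian]⟩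
    | tail _ hb ih =>
      obtain ⟨f, hf⟩ := ih (Or.inr ‹_›)
      obtain ⟨g, hg⟩ := bridge_linEquiv m hm _ _ hb
      exact ⟨f + g, by rw [lap_add, ← hf, ← hg]; abel⟩
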